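/- There exists no welfarist committee rule every one of whose output committees is in the core of the given instance. -/

import Mathlib

/-!
Common framework for approval-based committee elections
(Peters & Skowron, "Proportionality and the Limits of Welfarism").
-/

namespace ABC

/-- An election instance: a finite set `C` of candidates, a finite set `N` of voters,
an approval ballot `A i ⊆ C` for each voter `i`, and a committee size `k`. -/
structure Election where
  C : Finset ℕ
  N : Finset ℕ
  A : ℕ → Finset ℕ
  k : ℕ

/-- Basic well-formedness of an election instance: ballots are sets of candidates,
`k ≤ |C|`, and the instance is nondegenerate (`k ≥ 1`, `n ≥ 1`). -/
def Election.Valid (E : Election) : Prop :=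
  (∀ i ∈ E.N, E.A i ⊆ E.C) ∧ E.k ≤ E.C.card ∧ 0 < E.k ∧ 0 < E.N.card

/-- `C(P)`: the set of candidates approved by at least one voter. -/
def Election.CP (E : Election) : Finset ℕ := E.N.biUnion E.A

/-- The price `n/k`. -/
noncomputable def Election.price (E : Election) : ℝ := (E.N.card : ℝ) / (E.k : ℝ)

/-- `N(c)`: the set of voters approving candidate `c`. -/
def Election.approvers (E : Election) (c : ℕ) : Finset ℕ :=
  E.N.filter (fun i => c ∈ E.A i)

/-- A committee: a set of at most `k` candidates. -/
def Election.IsCommittee (E : Election) (W : Finset ℕ) : Prop :=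
  W ⊆ E.C ∧ W.card ≤ E.k

/-- The set of candidates approved by every voter in `S` (i.e. `⋂_{i ∈ S} A_i`). -/
def commonApproved (E : Election) (S : Finset ℕ) : Finset ℕ :=
  E.C.filter (fun c => ∀ i ∈ S, c ∈ E.A i)

/-! ### Price systems and priceability -/

/-- A price system: a positive price `p` and payment functions `pay i : C → [0,1]`,
where voter `i` pays only for candidates she approves and spends at most one dollar. -/
structure PriceSystem (E : Election) where
  p : ℝ
  pay : ℕ → ℕ → ℝ
  p_pos : 0 < p
  pay_nonneg : ∀ i c, 0 ≤ pay i c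
  pay_le_one : ∀ i c, pay i c ≤ 1
  pay_approved : ∀ i ∈ E.N, ∀ c : ℕ, 0 < pay i c → c ∈ E.A i
  pay_budget : ∀ i ∈ E.N, ∑ c ∈ E.C, pay i c ≤ 1

/-- The price system supports the committee `W`: every elected candidate receives
total payment `p`, unelected candidates receive nothing, and the supporters of an
unelected candidate have at most `p` unspent budget in total. -/
def PriceSystem.SupportsW {E : Election} (ps : PriceSystem E) (W : Finset ℕ) : Prop :=
  (∀ c ∈ W, ∑ i ∈ E.N, ps.pay i c = ps.p) ∧
  (∀ c : ℕ, c ∉ W → ∑ i ∈ E.N, ps.pay i c = 0) ∧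
  (∀ c ∈ E.C, c ∉ W →
    ∑ i ∈ E.approvers c, (1 - ∑ c' ∈ W, ps.pay i c') ≤ ps.p)

/-- A committee is priceable if some price system supports it. -/
def Priceable (E : Election) (W : Finset ℕ) : Prop :=
  ∃ ps : PriceSystem E, ps.SupportsW W

/-! ### Phragmén's sequential rule, via execution traces -/

/-- An execution trace of Phragmén's sequential rule: `elected j` is the candidate
elected in step `j` (for `j < k`), at time `time j`; `reset j i` is the time at which
voter `i`'s balance was last reset before step `j` (so her balance at time `t` is
`t - reset j i`).  A candidate is elected at the first moment at which its approvers
jointly hold `n/k` dollars.  -/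
structure PhragmenTrace (E : Election) where
  elected : ℕ → ℕ
  time : ℕ → ℝ
  reset : ℕ → ℕ → ℝ
  elected_mem : ∀ j < E.k, elected j ∈ E.C
  elected_inj : ∀ j < E.k, ∀ j' < E.k, elected j = elected j' → j = j'
  time_nonneg : ∀ j, 0 ≤ time j
  time_mono : ∀ j j', j ≤ j' → time j ≤ time j'
  reset_zero : ∀ i, reset 0 i = 0
  reset_succ : ∀ j i, reset (j + 1) i = if elected j ∈ E.A i then time j else reset j i
  /-- the elected candidate's approvers jointly hold exactly `n/k` at the election time -/
  elect_eq : ∀ j < E.k, ∑ i ∈ E.approvers (elected j), (time j - reset j i) = E.price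
  /-- no not-yet-elected candidate's approvers held more than `n/k` at any earlier moment -/
  first : ∀ j < E.k, ∀ c ∈ E.C, (∀ j' < j, elected j' ≠ c) →
    ∑ i ∈ E.approvers c, (time j - reset j i) ≤ E.price

/-- `W` is a possible output of Phragmén's sequential rule (under some tie-breaking). -/
def PhragmenOutput (E : Election) (W : Finset ℕ) : Prop :=
  ∃ tr : PhragmenTrace E, W = (Finset.range E.k).image tr.elected

/-! ### Rule X -/

/-- Candidate `c` (not yet elected) is `q`-affordable given budgets `b`:
its approvers can raise `n/k` while each paying at most `q`. -/
def Affordable (E : Election) (b : ℕ → ℝ) (W : Finset ℕ) (c : ℕ) (q : ℝ) : Prop :=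
  c ∈ E.C ∧ c ∉ W ∧ 0 ≤ q ∧ E.price ≤ ∑ i ∈ E.approvers c, min q (b i)

/-- Reachable states of Rule X: starting from budgets all equal to `1` and the empty
committee, repeatedly add a candidate that is `q`-affordable for the minimum possible `q`
(ties broken arbitrarily), charging each approver `min q (b i)`. -/
inductive RuleXReach (E : Election) : (ℕ → ℝ) → Finset ℕ → Prop
  | init : RuleXReach E (fun _ => 1) ∅
  | step {b : ℕ → ℝ} {W : Finset ℕ} {c : ℕ} {q : ℝ} :
      RuleXReach E b W →
      Affordable E b W c q →
      (∀ c' q', Affordable E b W c' q' → q ≤ q') →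
      RuleXReach E (fun i => if i ∈ E.approvers c then b i - min q (b i) else b i)
        (insert c W)

/-- `W` is a possible output of Rule X (under some tie-breaking): a reachable
committee from which no further candidate is `q`-affordable for any `q`. -/
def RuleXOutput (E : Election) (W : Finset ℕ) : Prop :=
  ∃ b : ℕ → ℝ, RuleXReach E b W ∧ ∀ c q, ¬ Affordable E b W c q

/-! ### Proportional Approval Voting -/

/-- The harmonic number `H(t) = 1 + 1/2 + ⋯ + 1/t` (with `H(0) = 0`). -/
noncomputable def hsum (t : ℕ) : ℝ := ∑ j ∈ Finset.range t, (1 : ℝ) / (j + 1)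

/-- The PAV score of a committee. -/
noncomputable def pavScore (E : Election) (W : Finset ℕ) : ℝ :=
  ∑ i ∈ E.N, hsum ((E.A i ∩ W).card)

/-- `W` is a PAV winning committee: it has maximal PAV score among committees of size at
most `k`. -/
def PavWinner (E : Election) (W : Finset ℕ) : Prop :=
  W ⊆ E.C ∧ W.card ≤ E.k ∧
  ∀ W' : Finset ℕ, W' ⊆ E.C → W'.card ≤ E.k → pavScore E W' ≤ pavScore E W

/-! ### The core and its approximations -/

/-- `W` is in the core: no nonempty group `S` of voters together with a set `T` of
candidates with `|T|/k ≤ |S|/n` gives every member of `S` strictly more approved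
candidates than `W` does. -/
def InCore (E : Election) (W : Finset ℕ) : Prop :=
  ¬ ∃ S T : Finset ℕ, S ⊆ E.N ∧ S.Nonempty ∧ T ⊆ E.C ∧
    T.card * E.N.card ≤ S.card * E.k ∧
    ∀ i ∈ S, (E.A i ∩ W).card < (E.A i ∩ T).card

/-- `W` is in the `λ`-core: no nonempty group `S` and set `T` with `|T|/k ≤ |S|/n`
and `|A_i ∩ T| > max (λ·|A_i ∩ W|) 1` for every `i ∈ S`. -/
def InLamCore (lam : ℝ) (E : Election) (W : Finset ℕ) : Prop :=
  ¬ ∃ S T : Finset ℕ, S ⊆ E.N ∧ S.Nonempty ∧ T ⊆ E.C ∧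
    T.card * E.N.card ≤ S.card * E.k ∧
    ∀ i ∈ S, max (lam * ((E.A i ∩ W).card : ℝ)) 1 < ((E.A i ∩ T).card : ℝ)

/-! ### Pigou–Dalton transfers -/

/-- `W` admits a Pigou–Dalton transfer: there is a committee `W'` of the same size and
voters `i, j` with `|A_j∩W| > |A_i∩W|` such that all other voters' utilities are
unchanged in `W'`, the combined utility of `i` and `j` is unchanged, and
`|A_j∩W| > |A_j∩W'| ≥ |A_i∩W'| > |A_i∩W|`. -/
def AdmitsPD (E : Election) (W : Finset ℕ) : Prop :=
  ∃ W' : Finset ℕ, W' ⊆ E.C ∧ W'.card = W.card ∧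
  ∃ i ∈ E.N, ∃ j ∈ E.N, i ≠ j ∧
    (E.A i ∩ W).card < (E.A j ∩ W).card ∧
    (∀ l ∈ E.N, l ≠ i → l ≠ j → (E.A l ∩ W').card = (E.A l ∩ W).card) ∧
    (E.A i ∩ W').card + (E.A j ∩ W').card = (E.A i ∩ W).card + (E.A j ∩ W).card ∧
    (E.A j ∩ W').card < (E.A j ∩ W).card ∧
    (E.A i ∩ W').card ≤ (E.A j ∩ W').card ∧
    (E.A i ∩ W).card < (E.A i ∩ W').card

/-! ### Laminar instances and laminar proportionality -/

/-- All ballots are equal. -/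
def Unanimous (E : Election) : Prop := ∀ i ∈ E.N, ∀ j ∈ E.N, E.A i = E.A j

/-- `P₋c`: remove candidate `c` from every ballot; the committee size drops by one. -/
def eraseCand (E : Election) (c : ℕ) : Election :=
  { C := E.C.erase c, N := E.N, A := fun i => (E.A i).erase c, k := E.k - 1 }

/-- `E` is the concatenation of two instances `E₁`, `E₂` on disjoint voter sets and
disjoint candidate sets, with `k = k₁ + k₂` and `n₁/k₁ = n₂/k₂`. -/
def Combines (E E₁ E₂ : Election) : Prop :=
  Disjoint E₁.N E₂.N ∧ Disjoint E₁.CP E₂.CP ∧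
  E.N = E₁.N ∪ E₂.N ∧
  (∀ i ∈ E₁.N, E.A i = E₁.A i) ∧ (∀ i ∈ E₂.N, E.A i = E₂.A i) ∧
  E.k = E₁.k + E₂.k ∧ 0 < E₁.k ∧ 0 < E₂.k ∧
  E₁.N.card * E₂.k = E₂.N.card * E₁.k

/-- Laminar election instances. -/
inductive Laminar : Election → Prop
  | unanimous (E : Election) : Unanimous E → E.k ≤ E.CP.card → Laminar E
  | consensus (E : Election) (c : ℕ) : 0 < E.k → c ∈ E.CP →
      (∀ i ∈ E.N, c ∈ E.A i) →
      ¬ Unanimous (eraseCand E c) → Laminar (eraseCand E c) → Laminar E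
  | combine (E E₁ E₂ : Election) : Combines E E₁ E₂ →
      Laminar E₁ → Laminar E₂ → Laminar E

/-- Laminar proportional committees for a laminar instance. -/
inductive LamProp : Election → Finset ℕ → Prop
  | unanimous (E : Election) (W : Finset ℕ) :
      Unanimous E → W ⊆ E.CP → W.card = E.k → LamProp E W
  | consensus (E : Election) (c : ℕ) (W' : Finset ℕ) : 0 < E.k → c ∈ E.CP →
      (∀ i ∈ E.N, c ∈ E.A i) → Laminar (eraseCand E c) →
      LamProp (eraseCand E c) W' → c ∉ W' → LamProp E (insert c W')
  | combine (E E₁ E₂ : Election) (W₁ W₂ : Finset ℕ) : Combines E E₁ E₂ →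
      LamProp E₁ W₁ → LamProp E₂ W₂ → LamProp E (W₁ ∪ W₂)

/-! ### Committee rules and welfarism -/

/-- The welfare vector of `W`: each voter's number of approved committee members
(indexed by voter name, `0` outside `N`). -/
def wvec (E : Election) (W : Finset ℕ) : ℕ → ℕ :=
  fun i => if i ∈ E.N then (E.A i ∩ W).card else 0

/-- A committee rule returns, on every (valid) instance, a nonempty set of committees
of size at most `k`. -/
def CommitteeRule (f : Election → Set (Finset ℕ)) : Prop :=
  ∀ E : Election, E.Valid → (f E).Nonempty ∧ ∀ W ∈ f E, W ⊆ E.C ∧ W.card ≤ E.k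

/-- A rule is welfarist if for each committee size `k` there is a function `g k` of the
welfare vector such that on every instance the rule returns exactly the size-`k`
committees maximizing `g k` of their welfare vector. -/
def Welfarist (f : Election → Set (Finset ℕ)) : Prop :=
  ∃ g : ℕ → (ℕ → ℕ) → ℝ, ∀ E : Election, E.Valid →
    f E = { W : Finset ℕ | W ⊆ E.C ∧ W.card = E.k ∧
      ∀ W' : Finset ℕ, W' ⊆ E.C → W'.card = E.k →
        g E.k (wvec E W') ≤ g E.k (wvec E W) }

/-- Pareto-optimality of a rule. -/
def ParetoOptimal (f : Election → Set (Finset ℕ)) : Prop :=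
  ∀ E : Election, E.Valid → ∀ W ∈ f E,
    ¬ ∃ W' : Finset ℕ, W' ⊆ E.C ∧ W'.card ≤ E.k ∧
      (∀ i ∈ E.N, (E.A i ∩ W).card ≤ (E.A i ∩ W').card) ∧
      (∃ i ∈ E.N, (E.A i ∩ W).card < (E.A i ∩ W').card)

/-! ### Party-list profiles -/

/-- A party-list profile: any two ballots are equal or disjoint. -/
def PartyList (E : Election) : Prop :=
  ∀ i ∈ E.N, ∀ j ∈ E.N, E.A i = E.A j ∨ Disjoint (E.A i) (E.A j)

/-- The number of voters supporting the party with ballot `B`. -/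
def nParty (E : Election) (B : Finset ℕ) : ℕ :=
  (E.N.filter (fun i => E.A i = B)).card

/-! ### Priceability with equal payments -/

/-- `T` is priceable with equal payments in the instance restricted to the voters in `S`
with committee size `|T|`: payments are in `[0,1]`, only for approved candidates,
each voter spends at most `1` on `T`, every `c ∈ T` receives exactly `|S|/|T|` in total,
and all voters paying for `c` pay the same amount. -/
def PriceableEq (E : Election) (S T : Finset ℕ) : Prop :=
  ∃ pay : ℕ → ℕ → ℝ,
    (∀ i c, 0 ≤ pay i c ∧ pay i c ≤ 1) ∧
    (∀ i ∈ S, ∀ c : ℕ, 0 < pay i c → c ∈ E.A i) ∧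
    (∀ i ∈ S, ∑ c ∈ T, pay i c ≤ 1) ∧
    (∀ c ∈ T, ∑ i ∈ S, pay i c = (S.card : ℝ) / (T.card : ℝ)) ∧
    (∀ c ∈ T, ∀ i ∈ S, ∀ j ∈ S, c ∈ E.A i → c ∈ E.A j → pay i c = pay j c)


/-! ### A family of elections with four voters and committee size eight -/

/-- The sets of two voters among the four voters `0, 1, 2, 3`. -/
def voterPairs : Finset (Finset ℕ) := (Finset.range 4).powersetCard 2

/-- Every voter approves three candidates. The two voters in `P` share the candidates `12` and
`13`, and each voter `i` is the only one to approve candidate `i`. -/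
def pairBallot (P : Finset ℕ) (i : ℕ) : Finset ℕ :=
  if i ∈ P then {i, 12, 13} else {i, 4 + i, 8 + i}

/-- The election with ballots `pairBallot P` and committee size `8`. -/
def pairElection (P : Finset ℕ) : Election where
  C := (Finset.range 4).biUnion (pairBallot P)
  N := Finset.range 4
  A := pairBallot P
  k := 8

/-- The welfare vector giving `2` to the voters in `Q` and `3` to the other ones. -/
def pairWelfare (Q : Finset ℕ) : ℕ → ℕ :=
  fun i => if i ∈ Finset.range 4 then (if i ∈ Q then 2 else 3) else 0

lemma pairBallot_subset {P : Finset ℕ} {i : ℕ} (hi : i ∈ Finset.range 4) :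
    pairBallot P i ⊆ (pairElection P).C :=
  Finset.subset_biUnion_of_mem (pairBallot P) hi

lemma card_pairBallot {P : Finset ℕ} {i : ℕ} (hi : i ∈ Finset.range 4) :
    (pairBallot P i).card = 3 := by
  have hi' := Finset.mem_range.1 hi
  unfold pairBallot
  split_ifs <;> refine Finset.card_eq_three.2 ⟨_, _, _, ?_, ?_, ?_, rfl⟩ <;> omega

lemma pairElection_valid {P : Finset ℕ} (hP : P ∈ voterPairs) : (pairElection P).Valid := by
  have h : ∀ P ∈ voterPairs, 8 ≤ ((Finset.range 4).biUnion (pairBallot P)).card := by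
    decide +kernel
  exact ⟨fun _ hi => pairBallot_subset hi, h P hP, by simp [pairElection], by simp [pairElection]⟩

/-- Leaving out the candidates in `Q` realizes the welfare vector `pairWelfare Q`. -/
lemma exists_committee_of_pairWelfare {P Q : Finset ℕ} (hP : P ∈ voterPairs)
    (hQ : Q ∈ voterPairs) :
    ∃ W ⊆ (pairElection P).C, W.card = 8 ∧ wvec (pairElection P) W = pairWelfare Q := by
  have h : ∀ P ∈ voterPairs, ∀ Q ∈ voterPairs, ((pairElection P).C \ Q).card = 8 ∧
      ∀ i ∈ Finset.range 4,
        (pairBallot P i ∩ ((pairElection P).C \ Q)).card = if i ∈ Q then 2 else 3 := by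
    decide +kernel
  obtain ⟨hcard, hwelf⟩ := h P hP Q hQ
  refine ⟨_, Finset.sdiff_subset, hcard, funext fun i => ?_⟩
  by_cases hi : i ∈ Finset.range 4
  · simpa [wvec, pairWelfare, pairElection, hi] using hwelf i hi
  · simp only [wvec, pairWelfare, pairElection, hi, if_false]

/-- The two voters in `P` deserve four seats, so one of them is fully satisfied in the core. -/
lemma InCore.exists_mem_three_le {P W : Finset ℕ} (hP : P ∈ voterPairs)
    (hW : InCore (pairElection P) W) : ∃ i ∈ P, 3 ≤ (pairBallot P i ∩ W).card := by
  by_contra! hlt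
  obtain ⟨hsub, hcard⟩ := Finset.mem_powersetCard.1 hP
  have h : ∀ P ∈ voterPairs, (P.biUnion (pairBallot P)).card = 4 := by decide +kernel
  refine hW ⟨P, P.biUnion (pairBallot P), hsub, Finset.card_pos.1 (by omega),
    Finset.biUnion_subset.2 fun i hi => pairBallot_subset (hsub hi), ?_, fun i hi => ?_⟩
  · simp [pairElection, h P hP, hcard]
  · change (pairBallot P i ∩ W).card < (pairBallot P i ∩ P.biUnion (pairBallot P)).card
    rw [Finset.inter_eq_left.2 (Finset.subset_biUnion_of_mem (pairBallot P) hi),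
      card_pairBallot (hsub hi)]
    exact hlt i hi

/-- Every single voter deserves two seats. -/
lemma InCore.two_le {P W : Finset ℕ} (hW : InCore (pairElection P) W) {i : ℕ}
    (hi : i ∈ Finset.range 4) : 2 ≤ (pairBallot P i ∩ W).card := by
  by_contra! hlt
  obtain ⟨T, hT, hcard⟩ := Finset.exists_subset_card_eq
    (show 2 ≤ (pairBallot P i).card by rw [card_pairBallot hi]; norm_num)
  refine hW ⟨{i}, T, Finset.singleton_subset_iff.2 hi, Finset.singleton_nonempty i,
    hT.trans (pairBallot_subset hi), ?_, fun j hj => ?_⟩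
  · simp [pairElection, hcard]
  · rw [Finset.mem_singleton.1 hj]
    change (pairBallot P i ∩ W).card < (pairBallot P i ∩ T).card
    rwa [Finset.inter_eq_right.2 hT, hcard]

lemma InCore.exists_wvec_eq_pairWelfare {P W : Finset ℕ} (hP : P ∈ voterPairs)
    (hsub : W ⊆ (pairElection P).C) (hcard : W.card = 8) (hW : InCore (pairElection P) W) :
    ∃ Q ∈ voterPairs, wvec (pairElection P) W = pairWelfare Q := by
  have h : ∀ P ∈ voterPairs, ∀ W ∈ (pairElection P).C.powersetCard 8,
      (∃ i ∈ P, 3 ≤ (pairBallot P i ∩ W).card) →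
      (∀ i ∈ Finset.range 4, 2 ≤ (pairBallot P i ∩ W).card) →
      ∃ Q ∈ voterPairs, ∀ i ∈ Finset.range 4,
        (pairBallot P i ∩ W).card = if i ∈ Q then 2 else 3 := by
    decide +kernel
  obtain ⟨Q, hQ, hwelf⟩ := h P hP W (Finset.mem_powersetCard.2 ⟨hsub, hcard⟩)
    (hW.exists_mem_three_le hP) fun _ hi => hW.two_le hi
  refine ⟨Q, hQ, funext fun i => ?_⟩
  by_cases hi : i ∈ Finset.range 4
  · simpa [wvec, pairWelfare, pairElection, hi] using hwelf i hi
  · simp only [wvec, pairWelfare, pairElection, hi, if_false]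

lemma InCore.wvec_ne_pairWelfare {P W : Finset ℕ} (hP : P ∈ voterPairs)
    (hW : InCore (pairElection P) W) : wvec (pairElection P) W ≠ pairWelfare P := by
  intro heq
  obtain ⟨i, hiP, hi⟩ := hW.exists_mem_three_le hP
  have hiN : i ∈ Finset.range 4 := (Finset.mem_powersetCard.1 hP).1 hiP
  have hval := congrFun heq i
  simp only [wvec, pairWelfare, pairElection, hiN, hiP, if_true] at hval
  omega

/-- There is no welfarist committee rule every one of whose output
committees is in the core. -/
theorem no_welfarist_core :
    ¬ ∃ f : Election → Set (Finset ℕ), CommitteeRule f ∧ Welfarist f ∧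
      (∀ E : Election, E.Valid → ∀ W ∈ f E, InCore E W) := by
  rintro ⟨f, hrule, ⟨g, hg⟩, hcore⟩
  obtain ⟨P, hP, hmax⟩ := voterPairs.exists_max_image (fun Q => g 8 (pairWelfare Q))
    ⟨{0, 1}, by decide⟩
  have hvalid := pairElection_valid hP
  have hfP := hg _ hvalid
  obtain ⟨W, hW⟩ := (hrule _ hvalid).1
  have hWcore := hcore _ hvalid W hW
  rw [hfP] at hW
  obtain ⟨hWC, hWk, hWmax⟩ := hW
  obtain ⟨Q, hQ, hWQ⟩ := hWcore.exists_wvec_eq_pairWelfare hP hWC hWk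
  obtain ⟨V, hVC, hVk, hVP⟩ := exists_committee_of_pairWelfare hP hP
  have hV : V ∈ f (pairElection P) := by
    rw [hfP]
    refine ⟨hVC, hVk, fun W' hW'C hW'k => (hWmax W' hW'C hW'k).trans ?_⟩
    rw [hWQ, hVP]
    exact hmax Q hQ
  exact (hcore _ hvalid V hV).wvec_ne_pairWelfare hP hVP

end ABC
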